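/- Let N ≥ 1, 0 < s < N/2, and v(x) = (1 + |x|^2)^{-N/2 + s} on R^N. Then (-Δ)^s v(x) = 4^s (Γ(N/2+s)/Γ(N/2-s)) (1 + |x|^2)^{-N/2 - s} for all x ∈ R^N. -/

import Mathlib

open MeasureTheory Filter

lemma fl_exp_second (a b : ℝ) (ha : 0 ≤ a) (hb : 0 ≤ b) :
    |Real.exp (-a) - Real.exp (-b) + Real.exp (-b) * (a - b)| ≤ (a - b) ^ 2 := by
  have e : Real.exp (-a) - Real.exp (-b) + Real.exp (-b) * (a - b)
      = Real.exp (-b) * (Real.exp (b - a) - 1 - (b - a)) := by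
    have : Real.exp (-a) = Real.exp (-b) * Real.exp (b - a) := by
      rw [← Real.exp_add]; congr 1; ring
    rw [this]; ring
  have hpos : 0 ≤ Real.exp (b - a) - 1 - (b - a) := by
    have := Real.add_one_le_exp (b - a); linarith
  have hb1 : Real.exp (-b) ≤ 1 := by rw [Real.exp_le_one_iff]; linarith
  have ha1 : Real.exp (-a) ≤ 1 := by rw [Real.exp_le_one_iff]; linarith
  have hb0 := Real.exp_pos (-b)
  rw [e, abs_of_nonneg (mul_nonneg hb0.le hpos)]
  rcases le_total (b - a) 1 with h1 | h1
  · have key : Real.exp (b - a) - 1 - (b - a) ≤ (a - b) ^ 2 := by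
      rcases le_total (-1) (b - a) with h2 | h2
      · have := Real.abs_exp_sub_one_sub_id_le (abs_le.mpr ⟨h2, h1⟩)
        rw [abs_of_nonneg hpos] at this
        nlinarith
      · have : Real.exp (b - a) ≤ 1 := by rw [Real.exp_le_one_iff]; linarith
        nlinarith
    nlinarith
  · have : Real.exp (-a) = Real.exp (-b) * Real.exp (b - a) := by
      rw [← Real.exp_add]; congr 1; ring
    nlinarith

lemma fl_D_bound {E : Type*} [NormedAddCommGroup E] [InnerProductSpace ℝ E] (x z : E) (t : ℝ)
    (ht : 0 ≤ t) :
    |2 * Real.exp (-(t * ‖x‖ ^ 2)) - Real.exp (-(t * ‖x + z‖ ^ 2)) - Real.exp (-(t * ‖x - z‖ ^ 2))|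
      ≤ (2 + 2 * t + 2 * t ^ 2 * (2 * ‖x‖ + 1) ^ 2) * min 1 (‖z‖ ^ 2) := by
  have hA : 0 ≤ t * ‖x + z‖ ^ 2 := by positivity
  have hB : 0 ≤ t * ‖x - z‖ ^ 2 := by positivity
  have hM : 0 ≤ t * ‖x‖ ^ 2 := by positivity
  rcases le_total 1 (‖z‖ ^ 2) with h | h
  · rw [min_eq_left h, mul_one]
    have l1 : ∀ a : ℝ, 0 ≤ a → Real.exp (-a) ≤ 1 := fun a ha => by
      rw [Real.exp_le_one_iff]; linarith
    have p1 := Real.exp_pos (-(t * ‖x + z‖ ^ 2))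
    have p2 := Real.exp_pos (-(t * ‖x - z‖ ^ 2))
    have p3 := Real.exp_pos (-(t * ‖x‖ ^ 2))
    have q1 := l1 _ hA
    have q2 := l1 _ hB
    have q3 := l1 _ hM
    have : 0 ≤ 2 * t + 2 * t ^ 2 * (2 * ‖x‖ + 1) ^ 2 := by positivity
    rw [abs_le]; constructor <;> linarith
  · rw [min_eq_right h]
    have h1 : ‖z‖ ≤ 1 := by
      have := norm_nonneg z
      nlinarith
    have k1 := fl_exp_second _ _ hA hM
    have k2 := fl_exp_second _ _ hB hM
    have n1 := norm_add_sq_real x z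
    have n2 := norm_sub_sq_real x z
    have ci : |inner ℝ x z| ≤ ‖x‖ * ‖z‖ := abs_real_inner_le_norm x z
    set i := inner ℝ x z
    have hx := norm_nonneg x
    have hz := norm_nonneg z
    have b1 : (t * ‖x + z‖ ^ 2 - t * ‖x‖ ^ 2) ^ 2 ≤ t ^ 2 * (2 * ‖x‖ + 1) ^ 2 * ‖z‖ ^ 2 := by
      rw [n1]
      have : (t * (‖x‖ ^ 2 + 2 * i + ‖z‖ ^ 2) - t * ‖x‖ ^ 2) ^ 2 = t ^ 2 * (2 * i + ‖z‖^2) ^ 2 := by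
        ring
      rw [this, mul_assoc, ← mul_pow (2 * ‖x‖ + 1)]
      apply mul_le_mul_of_nonneg_left _ (by positivity)
      apply sq_le_sq.mpr
      rw [abs_of_nonneg (a := (2 * ‖x‖ + 1) * ‖z‖) (by positivity)]
      have := abs_le.mp ci
      rw [abs_le]; constructor <;> nlinarith
    have b2 : (t * ‖x - z‖ ^ 2 - t * ‖x‖ ^ 2) ^ 2 ≤ t ^ 2 * (2 * ‖x‖ + 1) ^ 2 * ‖z‖ ^ 2 := by
      rw [n2]
      have : (t * (‖x‖ ^ 2 - 2 * i + ‖z‖ ^ 2) - t * ‖x‖ ^ 2) ^ 2 = t ^ 2 * (-2 * i + ‖z‖^2) ^ 2 := by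
        ring
      rw [this, mul_assoc, ← mul_pow (2 * ‖x‖ + 1)]
      apply mul_le_mul_of_nonneg_left _ (by positivity)
      apply sq_le_sq.mpr
      rw [abs_of_nonneg (a := (2 * ‖x‖ + 1) * ‖z‖) (by positivity)]
      have := abs_le.mp ci
      rw [abs_le]; constructor <;> nlinarith
    have hM1 : Real.exp (-(t * ‖x‖ ^ 2)) ≤ 1 := by rw [Real.exp_le_one_iff]; linarith
    have hM0 := Real.exp_pos (-(t * ‖x‖ ^ 2))
    have sum : Real.exp (-(t * ‖x‖ ^ 2)) * (t * ‖x + z‖ ^ 2 - t * ‖x‖ ^ 2) +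
        Real.exp (-(t * ‖x‖ ^ 2)) * (t * ‖x - z‖ ^ 2 - t * ‖x‖ ^ 2)
          = Real.exp (-(t * ‖x‖ ^ 2)) * (2 * t * ‖z‖ ^ 2) := by
      rw [n1, n2]; ring
    have s0 : 0 ≤ Real.exp (-(t * ‖x‖ ^ 2)) * (2 * t * ‖z‖ ^ 2) := by positivity
    have s1 : Real.exp (-(t * ‖x‖ ^ 2)) * (2 * t * ‖z‖ ^ 2) ≤ 2 * t * ‖z‖ ^ 2 :=
      mul_le_of_le_one_left (by positivity) hM1
    have z2 : 0 ≤ ‖z‖ ^ 2 := by positivity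
    rw [abs_le] at k1 k2 ⊢
    constructor <;> linarith [k1.1, k1.2, k2.1, k2.2]

lemma fl_integrableOn (f : ℝ → ℝ) (hf : Measurable f) (C α β : ℝ) (hα : -1 < α) (hβ : β < -1)
    (h0 : ∀ y, 0 < y → y ≤ 1 → |f y| ≤ C * y ^ α) (h1 : ∀ y, 1 < y → |f y| ≤ C * y ^ β) :
    IntegrableOn f (Set.Ioi 0) := by
  rw [← Set.Ioc_union_Ioi_eq_Ioi (zero_le_one (α := ℝ))]
  refine IntegrableOn.union ?_ ?_
  · have : IntegrableOn (fun y : ℝ => C * y ^ α) (Set.Ioc 0 1) := by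
      have := (intervalIntegral.intervalIntegrable_rpow' hα (a := 0) (b := 1)).const_mul C
      rwa [intervalIntegrable_iff_integrableOn_Ioc_of_le zero_le_one] at this
    refine Integrable.mono' this hf.aestronglyMeasurable ?_
    filter_upwards [ae_restrict_mem measurableSet_Ioc] with y hy
    exact h0 y hy.1 hy.2
  · have : IntegrableOn (fun y : ℝ => C * y ^ β) (Set.Ioi 1) :=
      ((integrableOn_Ioi_rpow_iff zero_lt_one).mpr hβ).const_mul C
    refine Integrable.mono' this hf.aestronglyMeasurable ?_
    filter_upwards [ae_restrict_mem measurableSet_Ioi] with y hy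
    exact h1 y hy

lemma fl_kernel (N : ℕ) (hN : 1 ≤ N) (s : ℝ) (hs : 0 < s) (hs1 : s < 1) :
    Integrable (fun z : EuclideanSpace ℝ (Fin N) =>
      min 1 (‖z‖ ^ 2) / ‖z‖ ^ ((N : ℝ) + 2 * s)) := by
  have : Nonempty (Fin N) := ⟨⟨0, hN⟩⟩
  rw [integrable_fun_norm_addHaar (volume : Measure (EuclideanSpace ℝ (Fin N)))
    (f := fun y : ℝ => min 1 (y ^ 2) / y ^ ((N : ℝ) + 2 * s))]
  rw [finrank_euclideanSpace_fin]
  have key : ∀ y : ℝ, 0 < y → y ^ (N - 1) • (min 1 (y ^ 2) / y ^ ((N : ℝ) + 2 * s))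
      = min 1 (y ^ 2) * y ^ (-1 - 2 * s) := by
    intro y hy
    rw [smul_eq_mul, ← Real.rpow_natCast, Nat.cast_sub hN, div_eq_mul_inv, ← Real.rpow_neg hy.le,
      mul_left_comm, ← Real.rpow_add hy]
    congr 2; push_cast; ring
  apply fl_integrableOn _ (by fun_prop) 1 (1 - 2 * s) (-1 - 2 * s) (by linarith) (by linarith)
  · intro y hy hy1
    rw [key y hy, abs_of_nonneg (by positivity), one_mul]
    calc _ ≤ y ^ 2 * y ^ (-1 - 2 * s) := by gcongr; exact min_le_right _ _
      _ = _ := by rw [← Real.rpow_natCast, ← Real.rpow_add hy]; congr 1; push_cast; ring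
  · intro y hy
    have hy0 : 0 < y := by linarith
    rw [key y hy0, abs_of_nonneg (by positivity)]
    gcongr; exact min_le_left _ _

lemma fl_int1_integrable (s : ℝ) (hs : 0 < s) (hs1 : s < 1) :
    IntegrableOn (fun t : ℝ => t ^ (-s - 1) * (1 - Real.exp (-t))) (Set.Ioi 0) := by
  have e0 : ∀ y : ℝ, 0 < y → 0 ≤ 1 - Real.exp (-y) := fun y hy => by
    have : Real.exp (-y) ≤ 1 := by rw [Real.exp_le_one_iff]; linarith
    linarith
  apply fl_integrableOn _ (by fun_prop) 1 (-s) (-s - 1) (by linarith) (by linarith)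
  · intro y hy hy1
    have := e0 y hy
    rw [abs_of_nonneg (by positivity), one_mul]
    calc _ ≤ y ^ (-s - 1) * y := by
          gcongr; have := Real.add_one_le_exp (-y); linarith
      _ = _ := by rw [← Real.rpow_add_one hy.ne']; congr 1; ring
  · intro y hy
    have hy0 : 0 < y := by linarith
    have := e0 y hy0
    rw [abs_of_nonneg (by positivity), one_mul]
    exact mul_le_of_le_one_right (by positivity) (by linarith [Real.exp_pos (-y)])

lemma fl_int1 (s : ℝ) (hs : 0 < s) (hs1 : s < 1) :
    ∫ t in Set.Ioi (0:ℝ), t ^ (-s - 1) * (1 - Real.exp (-t)) = Real.Gamma (1 - s) / s := by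
  have hi := fl_int1_integrable s hs hs1
  have hg : IntegrableOn (fun t : ℝ => t ^ (-s) * Real.exp (-t) / s) (Set.Ioi 0) := by
    have := (Real.GammaIntegral_convergent (s := 1 - s) (by linarith)).div_const s
    refine this.congr (ae_of_all _ fun t => ?_)
    simp only; rw [mul_comm, show 1 - s - 1 = -s by ring]
  have hG : ∫ t in Set.Ioi (0:ℝ), t ^ (-s) * Real.exp (-t) / s = Real.Gamma (1 - s) / s := by
    rw [integral_div, Real.Gamma_eq_integral (by linarith)]
    congr 1
    refine integral_congr_ae (ae_of_all _ fun t => ?_)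
    simp only; rw [mul_comm, show 1 - s - 1 = -s by ring]
  have e0 : ∀ y : ℝ, 0 ≤ y → 0 ≤ 1 - Real.exp (-y) := fun y hy => by
    have : Real.exp (-y) ≤ 1 := by rw [Real.exp_le_one_iff]; linarith
    linarith
  have main := integral_Ioi_of_hasDerivAt_of_tendsto (a := 0) (m := (0:ℝ))
    (f := fun t : ℝ => -(t ^ (-s) * (1 - Real.exp (-t)) / s))
    (f' := fun t : ℝ => t ^ (-s - 1) * (1 - Real.exp (-t)) - t ^ (-s) * Real.exp (-t) / s)
    ?_ ?_ (hi.sub hg) ?_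
  · rw [integral_sub hi hg, hG] at main
    simp at main
    linarith
  · have h0 : Tendsto (fun t : ℝ => t ^ (1 - s) / s) (nhdsWithin 0 (Set.Ici 0)) (nhds 0) := by
      have : ContinuousAt (fun t : ℝ => t ^ (1 - s) / s) 0 :=
        (Real.continuousAt_rpow_const 0 (1 - s) (Or.inr (by linarith))).div_const s
      have h := this.tendsto
      rw [Real.zero_rpow (by linarith), zero_div] at h
      exact h.mono_left nhdsWithin_le_nhds
    unfold ContinuousWithinAt
    simp only [neg_zero, Real.exp_zero, sub_self, mul_zero, zero_div]
    suffices h : Tendsto (fun t : ℝ => t ^ (-s) * (1 - Real.exp (-t)) / s)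
        (nhdsWithin 0 (Set.Ici 0)) (nhds 0) by simpa using h.neg
    refine squeeze_zero' ?_ ?_ h0
    · filter_upwards [self_mem_nhdsWithin] with t ht
      have : (0:ℝ) ≤ t := ht
      have := e0 t ht
      positivity
    · filter_upwards [self_mem_nhdsWithin] with t ht
      rcases (show (0:ℝ) ≤ t from ht).eq_or_lt with h | h
      · rw [← h]; simp; positivity
      · gcongr
        calc _ ≤ t ^ (-s) * t := by
              gcongr; have := Real.add_one_le_exp (-t); linarith
          _ = _ := by rw [← Real.rpow_add_one h.ne']; congr 1; ring
  · intro t ht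
    have ht : 0 < t := ht
    have d1 := (Real.hasDerivAt_rpow_const (x := t) (p := -s) (Or.inl ht.ne'))
    have d2 : HasDerivAt (fun x : ℝ => 1 - Real.exp (-x)) (Real.exp (-t)) t := by
      have := ((hasDerivAt_neg t).exp).const_sub 1
      simpa using this
    have d3 : HasDerivAt (fun t : ℝ => -(t ^ (-s) * (1 - Real.exp (-t)) / s))
      (-((-s * t ^ (-s - 1) * (1 - Real.exp (-t)) + t ^ (-s) * Real.exp (-t)) / s)) t :=
      ((d1.mul d2).div_const s).neg
    refine d3.congr_deriv ?_
    have hs0 : s ≠ 0 := hs.ne'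
    rw [neg_eq_iff_eq_neg, div_eq_iff hs0, neg_sub, sub_mul, div_mul_cancel₀ _ hs0]
    ring
  · rw [← neg_zero]
    refine Tendsto.neg (squeeze_zero' ?_ ?_ (g := fun t : ℝ => t ^ (-s) / s) ?_)
    · filter_upwards [eventually_ge_atTop 0] with t ht
      have := e0 t ht
      positivity
    · filter_upwards [eventually_ge_atTop 0] with t ht
      gcongr
      exact mul_le_of_le_one_right (by positivity) (by linarith [Real.exp_pos (-t)])
    · simpa using (tendsto_rpow_neg_atTop hs).div_const s

lemma fl_gamma_int {a r : ℝ} (ha : 0 < a) (hr : 0 < r) :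
    IntegrableOn (fun t : ℝ => t ^ (a - 1) * Real.exp (-(r * t))) (Set.Ioi 0) := by
  have := integrableOn_rpow_mul_exp_neg_mul_rpow (p := 1) (s := a - 1) (b := r) (by linarith)
    one_pos hr
  simpa using this

lemma fl_gamma {a r : ℝ} (ha : 0 < a) (hr : 0 < r) :
    ∫ t in Set.Ioi (0:ℝ), t ^ (a - 1) * Real.exp (-(r * t)) = r ^ (-a) * Real.Gamma a := by
  rw [Real.integral_rpow_mul_exp_neg_mul_Ioi ha hr, one_div, Real.inv_rpow hr.le,
    Real.rpow_neg hr.le]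

lemma fl_beta (n s : ℝ) (hn : 0 < n) (hs : 0 < s) (hs1 : s < 1) :
    ∫ u in Set.Ioi (0:ℝ), u ^ (s - 1) * (1 - (u / (1 + u)) ^ n)
      = Real.Gamma (n + s) * Real.Gamma (1 - s) / (s * Real.Gamma n) := by
  have e0 : ∀ y : ℝ, 0 ≤ y → 0 ≤ 1 - Real.exp (-y) := fun y hy => by
    have : Real.exp (-y) ≤ 1 := by rw [Real.exp_le_one_iff]; linarith
    linarith
  let f : ℝ → ℝ → ℝ := fun u t =>
    (t ^ (n - 1) * (1 - Real.exp (-t))) * (u ^ (n + s - 1) * Real.exp (-(t * u)))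
  have hin : ∀ t : ℝ, 0 < t → ∫ u in Set.Ioi (0:ℝ), f u t
      = Real.Gamma (n + s) * (t ^ (-s - 1) * (1 - Real.exp (-t))) := by
    intro t ht
    simp only [f]
    rw [integral_const_mul, fl_gamma (by linarith) ht]
    rw [show -s - 1 = (n - 1) + -(n + s) by ring, Real.rpow_add ht]
    ring
  have hfm : Measurable (Function.uncurry f) := by
    simp only [f, Function.uncurry_def]; fun_prop
  have hint : Integrable (Function.uncurry f)
      ((volume.restrict (Set.Ioi 0)).prod (volume.restrict (Set.Ioi 0))) := by
    rw [integrable_prod_iff' hfm.aestronglyMeasurable]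
    constructor
    · filter_upwards [ae_restrict_mem measurableSet_Ioi] with t ht
      exact (fl_gamma_int (a := n + s) (by linarith) ht).const_mul (t ^ (n - 1) * (1 - Real.exp (-t)))
    · refine ((fl_int1_integrable s hs hs1).const_mul (Real.Gamma (n + s))).congr ?_
      filter_upwards [ae_restrict_mem measurableSet_Ioi] with t ht
      rw [← hin t ht]
      refine setIntegral_congr_fun measurableSet_Ioi fun u hu => ?_
      have := e0 t (le_of_lt ht)
      have ht' : 0 < t := ht
      have hu' : 0 < u := hu
      simp only [Function.uncurry, f]
      rw [Real.norm_of_nonneg (by positivity)]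
  have sw := integral_integral_swap hint
  rw [setIntegral_congr_fun measurableSet_Ioi (fun t ht => hin t ht), integral_const_mul,
    fl_int1 s hs hs1] at sw
  have hl : ∀ u ∈ Set.Ioi (0:ℝ), ∫ t in Set.Ioi (0:ℝ), f u t
      = Real.Gamma n * (u ^ (s - 1) * (1 - (u / (1 + u)) ^ n)) := by
    intro u hu
    have hu : 0 < u := hu
    have e : ∀ t, f u t = u ^ (n + s - 1) * (t ^ (n - 1) * Real.exp (-(u * t))
        - t ^ (n - 1) * Real.exp (-((1 + u) * t))) := by
      intro t
      have : Real.exp (-((1 + u) * t)) = Real.exp (-t) * Real.exp (-(t * u)) := by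
        rw [← Real.exp_add]; congr 1; ring
      simp only [f]; rw [this, mul_comm u t]; ring
    simp_rw [e]
    rw [integral_const_mul, integral_sub (fl_gamma_int hn hu) (fl_gamma_int hn (by linarith)),
      fl_gamma hn hu, fl_gamma hn (by linarith), Real.div_rpow hu.le (by linarith),
      Real.rpow_neg hu.le, Real.rpow_neg (by linarith : (0:ℝ) ≤ 1 + u),
      show n + s - 1 = (s - 1) + n by ring, Real.rpow_add hu]
    have : u ^ n ≠ 0 := (Real.rpow_pos_of_pos hu n).ne'
    field_simp
  rw [setIntegral_congr_fun measurableSet_Ioi hl, integral_const_mul] at sw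
  have := (Real.Gamma_pos_of_pos hn).ne'
  field_simp at sw ⊢
  linarith

lemma fl_integrable_of_ne {α : Type*} [MeasurableSpace α] {μ : Measure α} {f : α → ℝ}
    (h : ∫ x, f x ∂μ ≠ 0) : Integrable f μ := by
  by_contra hf
  exact h (integral_undef hf)

lemma fl_gauss (N : ℕ) (x : EuclideanSpace ℝ (Fin N)) (t τ : ℝ) (ht : 0 ≤ t) (hτ : 0 < τ) :
    ∫ z : EuclideanSpace ℝ (Fin N), Real.exp (-(t * ‖x + z‖ ^ 2)) * Real.exp (-(τ * ‖z‖ ^ 2))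
      = (Real.pi / (t + τ)) ^ ((N : ℝ) / 2) * Real.exp (-(t * ‖x‖ ^ 2 * (τ / (t + τ)))) := by
  have hp : 0 < t + τ := by linarith
  have e : ∀ z : EuclideanSpace ℝ (Fin N),
      Real.exp (-(t * ‖x + z‖ ^ 2)) * Real.exp (-(τ * ‖z‖ ^ 2))
        = Real.exp (-(t + τ) * ‖z + (t / (t + τ)) • x‖ ^ 2)
          * Real.exp (-(t * ‖x‖ ^ 2 * (τ / (t + τ)))) := by
    intro z
    rw [← Real.exp_add, ← Real.exp_add]
    congr 1
    rw [norm_add_sq_real, norm_add_sq_real, real_inner_smul_right, norm_smul, Real.norm_of_nonneg (by positivity),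
      real_inner_comm]
    field_simp
    ring
  simp_rw [e]
  rw [integral_mul_const, integral_add_right_eq_self
    (fun z : EuclideanSpace ℝ (Fin N) => Real.exp (-(t + τ) * ‖z‖ ^ 2)),
    GaussianFourier.integral_rexp_neg_mul_sq_norm hp, finrank_euclideanSpace_fin]

lemma fl_gauss_integrable (N : ℕ) (x : EuclideanSpace ℝ (Fin N)) (t τ : ℝ) (ht : 0 ≤ t)
    (hτ : 0 < τ) : Integrable (fun z : EuclideanSpace ℝ (Fin N) =>
      Real.exp (-(t * ‖x + z‖ ^ 2)) * Real.exp (-(τ * ‖z‖ ^ 2))) := by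
  apply fl_integrable_of_ne
  rw [fl_gauss N x t τ ht hτ]
  have := Real.pi_pos
  positivity

lemma fl_inner (N : ℕ) (x : EuclideanSpace ℝ (Fin N)) (t τ : ℝ) (ht : 0 ≤ t) (hτ : 0 < τ) :
    ∫ z : EuclideanSpace ℝ (Fin N), (2 * Real.exp (-(t * ‖x‖ ^ 2)) - Real.exp (-(t * ‖x + z‖ ^ 2))
        - Real.exp (-(t * ‖x - z‖ ^ 2))) * Real.exp (-(τ * ‖z‖ ^ 2))
      = 2 * ((Real.pi / τ) ^ ((N : ℝ) / 2) * Real.exp (-(t * ‖x‖ ^ 2))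
        - (Real.pi / (t + τ)) ^ ((N : ℝ) / 2) * Real.exp (-(t * ‖x‖ ^ 2 * (τ / (t + τ))))) := by
  have i0 := fl_gauss_integrable N x 0 τ le_rfl hτ
  have g0 := fl_gauss N x 0 τ le_rfl hτ
  have i1 := fl_gauss_integrable N x t τ ht hτ
  have g1 := fl_gauss N x t τ ht hτ
  simp only [zero_mul, neg_zero, Real.exp_zero, one_mul, zero_add, mul_one] at i0 g0
  have i2 : Integrable (fun z : EuclideanSpace ℝ (Fin N) =>
      Real.exp (-(t * ‖x - z‖ ^ 2)) * Real.exp (-(τ * ‖z‖ ^ 2))) := by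
    simpa [sub_eq_add_neg] using i1.comp_neg
  have g2 : ∫ z : EuclideanSpace ℝ (Fin N),
      Real.exp (-(t * ‖x - z‖ ^ 2)) * Real.exp (-(τ * ‖z‖ ^ 2))
      = (Real.pi / (t + τ)) ^ ((N : ℝ) / 2) * Real.exp (-(t * ‖x‖ ^ 2 * (τ / (t + τ)))) := by
    rw [← g1, ← integral_neg_eq_self]
    simp [sub_eq_add_neg]
  simp_rw [sub_mul]
  have i01 : Integrable (fun z : EuclideanSpace ℝ (Fin N) =>
      2 * Real.exp (-(t * ‖x‖ ^ 2)) * Real.exp (-(τ * ‖z‖ ^ 2)) -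
      Real.exp (-(t * ‖x + z‖ ^ 2)) * Real.exp (-(τ * ‖z‖ ^ 2))) := (i0.const_mul _).sub i1
  rw [integral_sub i01 i2, integral_sub (i0.const_mul _) i1,
    integral_const_mul, g0, g1, g2]
  ring

lemma fl_Dt (N : ℕ) (hN : 1 ≤ N) (s : ℝ) (hs : 0 < s) (hs1 : s < 1)
    (x : EuclideanSpace ℝ (Fin N)) (t : ℝ) (ht : 0 < t) :
    ∫ z : EuclideanSpace ℝ (Fin N), (2 * Real.exp (-(t * ‖x‖ ^ 2)) - Real.exp (-(t * ‖x + z‖ ^ 2))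
        - Real.exp (-(t * ‖x - z‖ ^ 2))) / ‖z‖ ^ ((N : ℝ) + 2 * s)
      = 2 * Real.pi ^ ((N : ℝ) / 2) / Real.Gamma ((N : ℝ) / 2 + s) * (t ^ s *
        ∫ w in Set.Ioi (0:ℝ), w ^ (s - 1) * (Real.exp (-(t * ‖x‖ ^ 2)) - (w / (1 + w)) ^ ((N : ℝ) / 2)
          * Real.exp (-(t * ‖x‖ ^ 2 * (w / (1 + w)))))) := by
  have : Nonempty (Fin N) := ⟨⟨0, hN⟩⟩
  set n : ℝ := (N : ℝ) / 2 with hn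
  have hn0 : 0 < n := by
    have : (1:ℝ) ≤ N := by exact_mod_cast hN
    rw [hn]; linarith
  have hpn : (N : ℝ) + 2 * s = 2 * (n + s) := by rw [hn]; ring
  have hns : 0 < n + s := by linarith
  have hΓ := Real.Gamma_pos_of_pos hns
  let D : EuclideanSpace ℝ (Fin N) → ℝ := fun z =>
    2 * Real.exp (-(t * ‖x‖ ^ 2)) - Real.exp (-(t * ‖x + z‖ ^ 2)) - Real.exp (-(t * ‖x - z‖ ^ 2))
  have hDm : Measurable D := by simp only [D]; fun_prop
  have hk := fl_kernel N hN s hs hs1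
  have hDint : Integrable (fun z => D z / ‖z‖ ^ ((N : ℝ) + 2 * s)) := by
    refine (hk.const_mul (2 + 2 * t + 2 * t ^ 2 * (2 * ‖x‖ + 1) ^ 2)).mono'
      (hDm.div (by fun_prop)).aestronglyMeasurable (ae_of_all _ fun z => ?_)
    rw [norm_div, Real.norm_eq_abs, Real.norm_of_nonneg (by positivity), ← mul_div_assoc]
    gcongr
    exact fl_D_bound x z t ht.le
  let f : EuclideanSpace ℝ (Fin N) → ℝ → ℝ := fun z τ =>
    D z * (τ ^ (n + s - 1) * Real.exp (-(‖z‖ ^ 2 * τ)))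
  have hfm : Measurable (Function.uncurry f) := by
    simp only [f, Function.uncurry_def]; fun_prop
  have hgam : ∀ z : EuclideanSpace ℝ (Fin N), z ≠ 0 →
      ∫ τ in Set.Ioi (0:ℝ), τ ^ (n + s - 1) * Real.exp (-(‖z‖ ^ 2 * τ))
        = Real.Gamma (n + s) / ‖z‖ ^ ((N : ℝ) + 2 * s) := by
    intro z hz
    have hz' : 0 < ‖z‖ := norm_pos_iff.mpr hz
    rw [fl_gamma hns (by positivity), Real.rpow_neg (by positivity), hpn, Real.rpow_mul hz'.le]
    rw [Real.rpow_two]; field_simp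
  have hne : ∀ᵐ z : EuclideanSpace ℝ (Fin N), z ≠ 0 := by
    simp [ae_iff]
  have hint : Integrable (Function.uncurry f)
      ((volume : Measure (EuclideanSpace ℝ (Fin N))).prod (volume.restrict (Set.Ioi 0))) := by
    rw [integrable_prod_iff hfm.aestronglyMeasurable]
    constructor
    · filter_upwards [hne] with z hz
      have hz' : 0 < ‖z‖ := norm_pos_iff.mpr hz
      exact (fl_gamma_int (a := n + s) (r := ‖z‖ ^ 2) hns (by positivity)).const_mul (D z)
    · refine (hDint.norm.const_mul (Real.Gamma (n + s))).congr ?_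
      filter_upwards [hne] with z hz
      have hz' : 0 < ‖z‖ := norm_pos_iff.mpr hz
      have : ∫ τ in Set.Ioi (0:ℝ), ‖Function.uncurry f (z, τ)‖
          = ∫ τ in Set.Ioi (0:ℝ), ‖D z‖ * (τ ^ (n + s - 1) * Real.exp (-(‖z‖ ^ 2 * τ))) := by
        refine setIntegral_congr_fun measurableSet_Ioi fun τ hτ => ?_
        have hτ' : 0 < τ := hτ
        simp only [Function.uncurry, f]
        rw [norm_mul, Real.norm_of_nonneg (r := τ ^ (n + s - 1) * _) (by positivity)]
      rw [this, integral_const_mul, hgam z hz, norm_div,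
        Real.norm_of_nonneg (r := ‖z‖ ^ ((N : ℝ) + 2 * s)) (by positivity)]
      ring
  have sw := integral_integral_swap hint
  have hl : ∫ z, ∫ τ in Set.Ioi (0:ℝ), f z τ
      = Real.Gamma (n + s) * ∫ z, D z / ‖z‖ ^ ((N : ℝ) + 2 * s) := by
    rw [← integral_const_mul]
    refine integral_congr_ae ?_
    filter_upwards [hne] with z hz
    simp only [f]
    rw [integral_const_mul, hgam z hz]; ring
  let g : ℝ → ℝ := fun τ => τ ^ (s - 1) * (Real.exp (-(t * ‖x‖ ^ 2)) - (τ / (t + τ)) ^ n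
          * Real.exp (-(t * ‖x‖ ^ 2 * (τ / (t + τ)))))
  have hr : ∫ τ in Set.Ioi (0:ℝ), ∫ z, f z τ
      = 2 * Real.pi ^ n * ∫ τ in Set.Ioi (0:ℝ), g τ := by
    rw [← integral_const_mul]
    refine setIntegral_congr_fun measurableSet_Ioi fun τ hτ => ?_
    have hτ' : 0 < τ := hτ
    have : ∀ z, f z τ = τ ^ (n + s - 1) * (D z * Real.exp (-(τ * ‖z‖ ^ 2))) := by
      intro z; simp only [f]; rw [mul_comm τ]; ring
    simp_rw [this]
    rw [integral_const_mul, fl_inner N x t τ ht.le hτ']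
    simp only [g]
    rw [← hn, Real.div_rpow Real.pi_pos.le hτ'.le, Real.div_rpow Real.pi_pos.le (by linarith),
      Real.div_rpow hτ'.le (by linarith), show n + s - 1 = (s - 1) + n by ring, Real.rpow_add hτ']
    have h1 : 0 < τ ^ n := by positivity
    have h2 : 0 < (t + τ) ^ n := by positivity
    field_simp
  have hsc : ∫ τ in Set.Ioi (0:ℝ), g τ = t ^ s *
        ∫ w in Set.Ioi (0:ℝ), w ^ (s - 1) * (Real.exp (-(t * ‖x‖ ^ 2)) - (w / (1 + w)) ^ n
          * Real.exp (-(t * ‖x‖ ^ 2 * (w / (1 + w))))) := by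
    have h := integral_comp_mul_left_Ioi g 0 ht
    rw [mul_zero, smul_eq_mul, eq_comm, inv_mul_eq_iff_eq_mul₀ ht.ne'] at h
    have hts : t ^ s = t * t ^ (s - 1) := by
      rw [mul_comm, ← Real.rpow_add_one ht.ne']; congr 1; ring
    rw [h, hts, mul_assoc]
    congr 1
    rw [← integral_const_mul]
    refine setIntegral_congr_fun measurableSet_Ioi fun w hw => ?_
    have hw' : 0 < w := hw
    simp only [g]
    have : t * w / (t + t * w) = w / (1 + w) := by field_simp
    rw [this, Real.mul_rpow ht.le hw'.le]
    ring
  rw [hl, hr, hsc] at sw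
  change ∫ z, D z / ‖z‖ ^ ((N : ℝ) + 2 * s) = _
  rw [div_mul_eq_mul_div, eq_div_iff hΓ.ne', mul_comm, sw]

lemma fl_tw (n s r : ℝ) (hn : 0 < n) (hs : 0 < s) (hs1 : s < 1) (hr : 0 ≤ r) :
    ∫ t in Set.Ioi (0:ℝ), t ^ (n - 1) * Real.exp (-t) * ∫ w in Set.Ioi (0:ℝ),
      w ^ (s - 1) * (Real.exp (-(t * r)) - (w / (1 + w)) ^ n * Real.exp (-(t * r * (w / (1 + w)))))
      = (1 + r) ^ (-n - s) * (Real.Gamma (n + s) * Real.Gamma (1 - s) / s) := by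
  have hΓ := Real.Gamma_pos_of_pos hn
  let f : ℝ → ℝ → ℝ := fun t w => t ^ (n - 1) * Real.exp (-t) * (w ^ (s - 1) *
    (Real.exp (-(t * r)) - (w / (1 + w)) ^ n * Real.exp (-(t * r * (w / (1 + w))))))
  have hfm : Measurable (Function.uncurry f) := by
    simp only [f, Function.uncurry_def]; fun_prop
  have hJ : ∀ m : ℝ, 0 < m → IntegrableOn (fun u : ℝ => u ^ (s - 1) * (1 - (u / (1 + u)) ^ m))
      (Set.Ioi 0) := by
    intro m hm
    apply fl_integrable_of_ne
    rw [fl_beta m s hm hs hs1]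
    have h1 := Real.Gamma_pos_of_pos hm
    have h2 := Real.Gamma_pos_of_pos (show 0 < m + s by linarith)
    have h3 := Real.Gamma_pos_of_pos (show 0 < 1 - s by linarith)
    positivity
  have hT : ∀ m : ℝ, 0 < m → IntegrableOn (fun t : ℝ => t ^ (m - 1) * Real.exp (-t))
      (Set.Ioi 0) := by
    intro m hm
    simpa using fl_gamma_int hm one_pos
  have hint : Integrable (Function.uncurry f)
      ((volume.restrict (Set.Ioi 0)).prod (volume.restrict (Set.Ioi 0))) := by
    have b1 := (((hT (n + 1) (by linarith)).const_mul r).mul_prod (hJ 1 one_pos))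
    have b2 := ((hT n hn).mul_prod (hJ n hn))
    refine (b1.add b2).mono' hfm.aestronglyMeasurable ?_
    rw [Measure.prod_restrict]
    filter_upwards [ae_restrict_mem (measurableSet_Ioi.prod measurableSet_Ioi)] with p hp
    obtain ⟨t, w⟩ := p
    have ht : 0 < t := hp.1
    have hw : 0 < w := hp.2
    simp only [Function.uncurry, f, Pi.add_apply]
    rw [norm_mul, norm_mul (w ^ (s - 1)), Real.norm_of_nonneg (r := t ^ (n - 1) * _) (by positivity),
      Real.norm_of_nonneg (r := w ^ (s - 1)) (by positivity), Real.norm_eq_abs]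
    set q := w / (1 + w) with hq
    have hq0 : 0 < q := by positivity
    have hq1 : q < 1 := by rw [hq, div_lt_one (by linarith)]; linarith
    have hqn0 : 0 < q ^ n := by positivity
    have hqn1 : q ^ n ≤ 1 := Real.rpow_le_one hq0.le hq1.le hn.le
    have htr : 0 ≤ t * r := by positivity
    have hE1 : Real.exp (-(t * r * q)) ≤ 1 := by
      rw [Real.exp_le_one_iff]; nlinarith
    have hE0 := Real.exp_pos (-(t * r * q))
    have hA : Real.exp (-(t * r)) ≤ Real.exp (-(t * r * q)) := by
      rw [Real.exp_le_exp]; nlinarith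
    have hB : Real.exp (-(t * r * q)) - Real.exp (-(t * r)) ≤ t * r * (1 - q) := by
      have h1 : Real.exp (-(t * r)) = Real.exp (-(t * r * q)) * Real.exp (-(t * r * (1 - q))) := by
        rw [← Real.exp_add]; congr 1; ring
      have h2 := Real.add_one_le_exp (-(t * r * (1 - q)))
      have h3 : 0 ≤ t * r * (1 - q) := mul_nonneg htr (by linarith)
      rw [h1]
      nlinarith
    have key : |Real.exp (-(t * r)) - q ^ n * Real.exp (-(t * r * q))|
        ≤ t * r * (1 - q) + (1 - q ^ n) := by
      have h3 : 0 ≤ t * r * (1 - q) := mul_nonneg htr (by linarith)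
      rw [abs_le]; constructor <;> nlinarith
    rw [Real.rpow_one, show n + 1 - 1 = (n - 1) + 1 by ring, Real.rpow_add_one ht.ne']
    calc _ ≤ t ^ (n - 1) * Real.exp (-t) * (w ^ (s - 1) * (t * r * (1 - q) + (1 - q ^ n))) := by
          gcongr
      _ = _ := by ring
  have sw := integral_integral_swap hint
  have hl : ∫ t in Set.Ioi (0:ℝ), ∫ w in Set.Ioi (0:ℝ), f t w
      = ∫ t in Set.Ioi (0:ℝ), t ^ (n - 1) * Real.exp (-t) * ∫ w in Set.Ioi (0:ℝ),
      w ^ (s - 1) * (Real.exp (-(t * r)) - (w / (1 + w)) ^ n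
        * Real.exp (-(t * r * (w / (1 + w))))) := by
    simp only [f, integral_const_mul]
  rw [← hl, sw]
  let g : ℝ → ℝ := fun u => u ^ (s - 1) * (1 - (u / (1 + u)) ^ n)
  have h1r : 0 < 1 + r := by linarith
  have hw : ∀ w ∈ Set.Ioi (0:ℝ), ∫ t in Set.Ioi (0:ℝ), f t w
      = Real.Gamma n * (1 + r) ^ (-n - s + 1) * g ((1 + r) * w) := by
    intro w hw
    have hw : 0 < w := hw
    set q := w / (1 + w) with hq
    have hq0 : 0 < q := by positivity
    have e : ∀ t, f t w = w ^ (s - 1) * (t ^ (n - 1) * Real.exp (-((1 + r) * t))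
        - q ^ n * (t ^ (n - 1) * Real.exp (-((1 + r * q) * t)))) := by
      intro t
      have h1 : Real.exp (-((1 + r) * t)) = Real.exp (-t) * Real.exp (-(t * r)) := by
        rw [← Real.exp_add]; congr 1; ring
      have h2 : Real.exp (-((1 + r * q) * t)) = Real.exp (-t) * Real.exp (-(t * r * q)) := by
        rw [← Real.exp_add]; congr 1; ring
      simp only [f]; rw [h1, h2]; ring
    have h1q : 0 < 1 + r * q := by positivity
    simp_rw [e]
    rw [integral_const_mul, integral_sub (fl_gamma_int hn h1r) ((fl_gamma_int hn h1q).const_mul _),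
      integral_const_mul, fl_gamma hn h1r, fl_gamma hn h1q]
    have h3 : q ^ n * (1 + r * q) ^ (-n)
        = (1 + r) ^ (-n) * ((1 + r) * w / (1 + (1 + r) * w)) ^ n := by
      rw [Real.rpow_neg h1q.le, ← div_eq_mul_inv, ← Real.div_rpow hq0.le h1q.le,
        Real.rpow_neg h1r.le, mul_comm ((1 + r) ^ n)⁻¹, ← div_eq_mul_inv, ← Real.div_rpow (by positivity) h1r.le]
      congr 1
      rw [hq]; field_simp; ring
    simp only [g]
    have h4 : (1 + r) ^ (-n) = (1 + r) ^ (-n - s + 1) * (1 + r) ^ (s - 1) := by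
      rw [← Real.rpow_add h1r]; congr 1; ring
    rw [← mul_assoc, h3, Real.mul_rpow h1r.le hw.le, h4]
    ring
  rw [setIntegral_congr_fun measurableSet_Ioi hw, integral_const_mul,
    integral_comp_mul_left_Ioi g 0 h1r, mul_zero, smul_eq_mul, fl_beta n s hn hs hs1,
    Real.rpow_add_one h1r.ne']
  field_simp

lemma fl_main (N : ℕ) (hN : 1 ≤ N) (s : ℝ) (hs : 0 < s) (hs1 : s < 1) (hsN : 2 * s < N)
    (v : EuclideanSpace ℝ (Fin N) → ℝ)
    (hv : v = fun x => (1 + ‖x‖ ^ 2) ^ (-(N : ℝ) / 2 + s)) (x : EuclideanSpace ℝ (Fin N)) :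
    Integrable (fun z => (2 * v x - v (x + z) - v (x - z)) / ‖z‖ ^ ((N : ℝ) + 2 * s)) ∧
    ∫ z, (2 * v x - v (x + z) - v (x - z)) / ‖z‖ ^ ((N : ℝ) + 2 * s)
      = 2 * Real.pi ^ ((N : ℝ) / 2) * Real.Gamma (1 - s) / (s * Real.Gamma ((N : ℝ) / 2 - s)) *
        (1 + ‖x‖ ^ 2) ^ (-(N : ℝ) / 2 - s) := by
  set n : ℝ := (N : ℝ) / 2 with hn
  have ha : 0 < n - s := by rw [hn]; linarith
  have hn0 : 0 < n := by linarith
  have hΓa := Real.Gamma_pos_of_pos ha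
  have hΓn := Real.Gamma_pos_of_pos (show 0 < n + s by linarith)
  let D : EuclideanSpace ℝ (Fin N) → ℝ → ℝ := fun z t =>
    2 * Real.exp (-(t * ‖x‖ ^ 2)) - Real.exp (-(t * ‖x + z‖ ^ 2)) - Real.exp (-(t * ‖x - z‖ ^ 2))
  let F : EuclideanSpace ℝ (Fin N) → ℝ → ℝ := fun z t =>
    (t ^ (n - s - 1) * Real.exp (-t)) * (D z t / ‖z‖ ^ ((N : ℝ) + 2 * s))
  have hFm : Measurable (Function.uncurry F) := by
    simp only [F, D, Function.uncurry_def]; fun_prop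
  have hT : ∀ m : ℝ, 0 < m → IntegrableOn (fun t : ℝ => t ^ (m - 1) * Real.exp (-t))
      (Set.Ioi 0) := by
    intro m hm
    simpa using fl_gamma_int hm one_pos
  have hk := fl_kernel N hN s hs hs1
  have hint : Integrable (Function.uncurry F)
      ((volume : Measure (EuclideanSpace ℝ (Fin N))).prod (volume.restrict (Set.Ioi 0))) := by
    have b0 := hk.mul_prod ((hT (n - s) ha).const_mul 2)
    have b1 := hk.mul_prod ((hT (n - s + 1) (by linarith)).const_mul 2)
    have b2 := hk.mul_prod ((hT (n - s + 2) (by linarith)).const_mul (2 * (2 * ‖x‖ + 1) ^ 2))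
    refine ((b0.add b1).add b2).mono' hFm.aestronglyMeasurable ?_
    have : (volume : Measure (EuclideanSpace ℝ (Fin N))).prod (volume.restrict (Set.Ioi (0:ℝ)))
        = ((volume : Measure (EuclideanSpace ℝ (Fin N))).prod volume).restrict
          (Set.univ ×ˢ Set.Ioi (0:ℝ)) := by
      rw [← Measure.prod_restrict, Measure.restrict_univ]
    rw [this]
    filter_upwards [ae_restrict_mem (MeasurableSet.univ.prod measurableSet_Ioi)] with p hp
    obtain ⟨z, t⟩ := p
    have ht : 0 < t := hp.2
    have hD := fl_D_bound x z t ht.le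
    simp only [Function.uncurry, F, Pi.add_apply]
    rw [norm_mul, norm_div, Real.norm_of_nonneg (r := t ^ (n - s - 1) * _) (by positivity),
      Real.norm_of_nonneg (r := ‖z‖ ^ _) (by positivity), Real.norm_eq_abs]
    have e1 : t ^ (n - s + 1 - 1) = t ^ (n - s - 1) * t := by
      rw [← Real.rpow_add_one ht.ne']; congr 1; ring
    have e2 : t ^ (n - s + 2 - 1) = t ^ (n - s - 1) * t ^ 2 := by
      rw [← Real.rpow_two, ← Real.rpow_add ht]; congr 1; ring
    rw [e1, e2]
    calc _ ≤ t ^ (n - s - 1) * Real.exp (-t) *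
          ((2 + 2 * t + 2 * t ^ 2 * (2 * ‖x‖ + 1) ^ 2) * min 1 (‖z‖ ^ 2)
            / ‖z‖ ^ ((N : ℝ) + 2 * s)) := by
          gcongr
      _ = _ := by ring
  have hvy : ∀ y, ∫ t in Set.Ioi (0:ℝ), t ^ (n - s - 1) * Real.exp (-((1 + ‖y‖ ^ 2) * t))
      = v y * Real.Gamma (n - s) := by
    intro y
    rw [fl_gamma ha (by positivity), hv]
    simp only
    congr 2; rw [hn]; ring
  have hz : ∀ z, ∫ t in Set.Ioi (0:ℝ), F z t = Real.Gamma (n - s) *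
      ((2 * v x - v (x + z) - v (x - z)) / ‖z‖ ^ ((N : ℝ) + 2 * s)) := by
    intro z
    have e : ∀ t, F z t = (‖z‖ ^ ((N : ℝ) + 2 * s))⁻¹ *
        (2 * (t ^ (n - s - 1) * Real.exp (-((1 + ‖x‖ ^ 2) * t)))
          - t ^ (n - s - 1) * Real.exp (-((1 + ‖x + z‖ ^ 2) * t))
          - t ^ (n - s - 1) * Real.exp (-((1 + ‖x - z‖ ^ 2) * t))) := by
      intro t
      have h1 : ∀ r : ℝ, Real.exp (-((1 + r) * t)) = Real.exp (-t) * Real.exp (-(t * r)) := by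
        intro r
        rw [← Real.exp_add]; congr 1; ring
      simp only [F, D]; rw [h1, h1, h1]; ring
    have i : ∀ y : EuclideanSpace ℝ (Fin N), IntegrableOn
        (fun t : ℝ => t ^ (n - s - 1) * Real.exp (-((1 + ‖y‖ ^ 2) * t))) (Set.Ioi 0) :=
      fun y => fl_gamma_int ha (by positivity)
    have i01 : IntegrableOn (fun t : ℝ => 2 * (t ^ (n - s - 1) * Real.exp (-((1 + ‖x‖ ^ 2) * t)))
          - t ^ (n - s - 1) * Real.exp (-((1 + ‖x + z‖ ^ 2) * t))) (Set.Ioi 0) :=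
      ((i x).const_mul 2).sub (i (x + z))
    simp_rw [e]
    rw [integral_const_mul, integral_sub i01 (i (x - z)), integral_sub ((i x).const_mul 2) (i (x + z)),
      integral_const_mul, hvy, hvy, hvy]
    ring
  have hI1 := hint.integral_prod_left
  simp only [Function.uncurry, hz] at hI1
  constructor
  · refine (hI1.const_mul (Real.Gamma (n - s))⁻¹).congr (ae_of_all _ fun z => ?_)
    simp only
    rw [inv_mul_cancel_left₀ hΓa.ne']
  · have sw := integral_integral_swap hint
    simp only [hz] at sw
    rw [integral_const_mul] at sw
    have ht : ∀ t ∈ Set.Ioi (0:ℝ), ∫ z, F z t = 2 * Real.pi ^ n / Real.Gamma (n + s) *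
        (t ^ (n - 1) * Real.exp (-t) * ∫ w in Set.Ioi (0:ℝ), w ^ (s - 1) *
          (Real.exp (-(t * ‖x‖ ^ 2)) - (w / (1 + w)) ^ n
          * Real.exp (-(t * ‖x‖ ^ 2 * (w / (1 + w)))))) := by
      intro t ht
      have ht : 0 < t := ht
      simp only [F, D]
      rw [integral_const_mul, fl_Dt N hN s hs hs1 x t ht, ← hn,
        show n - 1 = (n - s - 1) + s by ring, Real.rpow_add ht]
      ring
    rw [setIntegral_congr_fun measurableSet_Ioi ht, integral_const_mul,
      fl_tw n s (‖x‖ ^ 2) hn0 hs hs1 (by positivity)] at sw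
    rw [mul_comm, ← eq_div_iff hΓa.ne'] at sw
    rw [sw, show -(N : ℝ) / 2 - s = -n - s by rw [hn]; ring]
    field_simp

theorem stmt14 (N : ℕ) (hN : 1 ≤ N) (s : ℝ) (hs : 0 < s) (hs1 : s < 1)
    (hsN : 2 * s < N)
    (v : EuclideanSpace ℝ (Fin N) → ℝ)
    (hv : v = fun x => (1 + ‖x‖ ^ 2) ^ (-(N : ℝ) / 2 + s)) :
    ∀ x : EuclideanSpace ℝ (Fin N),
      Tendsto (fun ε : ℝ =>
          ∫ y in {y : EuclideanSpace ℝ (Fin N) | ε ≤ ‖x - y‖},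
            (4 ^ s * Real.pi ^ (-(N : ℝ) / 2) *
              (Real.Gamma ((N : ℝ) / 2 + s) / Real.Gamma (2 - s)) * (s * (1 - s))) *
              (v x - v y) / ‖x - y‖ ^ ((N : ℝ) + 2 * s))
        (nhdsWithin 0 (Set.Ioi 0))
        (nhds (4 ^ s * (Real.Gamma ((N : ℝ) / 2 + s) / Real.Gamma ((N : ℝ) / 2 - s)) *
          (1 + ‖x‖ ^ 2) ^ (-(N : ℝ) / 2 - s))) := by
  intro x
  have : Nonempty (Fin N) := ⟨⟨0, hN⟩⟩
  obtain ⟨hI, hval⟩ := fl_main N hN s hs hs1 hsN v hv x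
  set c : ℝ := 4 ^ s * Real.pi ^ (-(N : ℝ) / 2) *
    (Real.Gamma ((N : ℝ) / 2 + s) / Real.Gamma (2 - s)) * (s * (1 - s)) with hc
  have hvm : Measurable v := by rw [hv]; fun_prop
  have hv0 : ∀ y, 0 ≤ v y := by intro y; rw [hv]; positivity
  have hv1 : ∀ y, v y ≤ 1 := by
    intro y; rw [hv]
    exact Real.rpow_le_one_of_one_le_of_nonpos (by nlinarith [sq_nonneg ‖y‖]) (by linarith)
  have hk := fl_kernel N hN s hs hs1
  let S : ℝ → Set (EuclideanSpace ℝ (Fin N)) := fun ε => {z | ε ≤ ‖z‖}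
  have hS : ∀ ε, MeasurableSet (S ε) := fun ε =>
    measurableSet_le measurable_const measurable_norm
  let G : EuclideanSpace ℝ (Fin N) → ℝ := fun z =>
    (2 * v x - v (x + z) - v (x - z)) / ‖z‖ ^ ((N : ℝ) + 2 * s)
  -- symmetrization
  have hsym : ∀ ε : ℝ, 0 < ε →
      ∫ y in {y : EuclideanSpace ℝ (Fin N) | ε ≤ ‖x - y‖},
        c * (v x - v y) / ‖x - y‖ ^ ((N : ℝ) + 2 * s)
      = c / 2 * ∫ z, (S ε).indicator G z := by
    intro ε hε
    let g : EuclideanSpace ℝ (Fin N) → ℝ :=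
      (S ε).indicator fun z => (v x - v (x - z)) / ‖z‖ ^ ((N : ℝ) + 2 * s)
    have hgm : Measurable g := by
      refine Measurable.indicator ?_ (hS ε)
      have : Measurable fun z => v (x - z) := hvm.comp (by fun_prop)
      fun_prop
    have hg : Integrable g := by
      have hm : 0 < min 1 (ε ^ 2) := by positivity
      refine (hk.const_mul (min 1 (ε ^ 2))⁻¹).mono' hgm.aestronglyMeasurable
        (ae_of_all _ fun z => ?_)
      simp only [g]
      by_cases hz : z ∈ S ε
      · rw [Set.indicator_of_mem hz]
        have hz' : ε ≤ ‖z‖ := hz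
        rw [norm_div, Real.norm_of_nonneg (r := ‖z‖ ^ _) (by positivity), ← mul_div_assoc]
        gcongr
        have h1 : ‖v x - v (x - z)‖ ≤ 1 := by
          rw [Real.norm_eq_abs, abs_le]
          constructor <;> linarith [hv0 x, hv1 x, hv0 (x - z), hv1 (x - z)]
        refine h1.trans ?_
        rw [inv_mul_eq_div, one_le_div hm]
        gcongr
      · rw [Set.indicator_of_notMem hz, norm_zero]; positivity
    have e1 : ∫ y in {y : EuclideanSpace ℝ (Fin N) | ε ≤ ‖x - y‖},
        c * (v x - v y) / ‖x - y‖ ^ ((N : ℝ) + 2 * s) = c * ∫ z, g z := by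
      rw [← integral_sub_left_eq_self g volume x, ← integral_const_mul, ← integral_indicator
        (measurableSet_le measurable_const (by fun_prop))]
      refine integral_congr_ae (ae_of_all _ fun y => ?_)
      simp only [g, Set.indicator, S, Set.mem_ofPred_eq, sub_sub_cancel]
      split_ifs
      · ring
      · ring
    have e2 : ∫ z, (S ε).indicator G z = ∫ z, g z + g (-z) := by
      refine integral_congr_ae (ae_of_all _ fun z => ?_)
      simp only [g, G, Set.indicator, S, Set.mem_ofPred_eq, norm_neg, sub_neg_eq_add]
      split_ifs
      · ring
      · ring
    rw [e1, e2, integral_add hg hg.comp_neg, integral_neg_eq_self]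
    ring
  have hlim : Tendsto (fun ε : ℝ => ∫ z, (S ε).indicator G z) (nhdsWithin 0 (Set.Ioi 0))
      (nhds (∫ z, G z)) := by
    refine tendsto_integral_filter_of_dominated_convergence (fun z => ‖G z‖) ?_ ?_ hI.norm ?_
    · exact Eventually.of_forall fun ε => hI.aestronglyMeasurable.indicator (hS ε)
    · exact Eventually.of_forall fun ε => ae_of_all _ fun z => norm_indicator_le_norm_self _ _
    · have hne : ∀ᵐ z : EuclideanSpace ℝ (Fin N), z ≠ 0 := by
        simp [ae_iff]
      filter_upwards [hne] with z hz
      have hz' : 0 < ‖z‖ := norm_pos_iff.mpr hz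
      refine tendsto_const_nhds.congr' ?_
      have : ∀ᶠ ε : ℝ in nhdsWithin 0 (Set.Ioi 0), ε < ‖z‖ :=
        nhdsWithin_le_nhds (eventually_lt_nhds hz')
      filter_upwards [this] with ε hε
      rw [Set.indicator_of_mem]
      exact hε.le
  have hfin : 4 ^ s * (Real.Gamma ((N : ℝ) / 2 + s) / Real.Gamma ((N : ℝ) / 2 - s)) *
          (1 + ‖x‖ ^ 2) ^ (-(N : ℝ) / 2 - s) = c / 2 * ∫ z, G z := by
    have hΓa := Real.Gamma_pos_of_pos (show 0 < (N : ℝ) / 2 - s by linarith)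
    have hΓs := Real.Gamma_pos_of_pos (show 0 < 1 - s by linarith)
    have h2 : Real.Gamma (2 - s) = (1 - s) * Real.Gamma (1 - s) := by
      rw [← Real.Gamma_add_one (by linarith)]; congr 1; ring
    have hπ : Real.pi ^ (-(N : ℝ) / 2) = (Real.pi ^ ((N : ℝ) / 2))⁻¹ := by
      rw [← Real.rpow_neg Real.pi_pos.le]; congr 1; ring
    have hπ0 : 0 < Real.pi ^ ((N : ℝ) / 2) := Real.rpow_pos_of_pos Real.pi_pos _
    have h1s : 1 - s ≠ 0 := by linarith
    simp only [G]
    rw [hval, hc, h2, hπ]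
    field_simp
  rw [hfin]
  refine (hlim.const_mul (c / 2)).congr' ?_
  filter_upwards [self_mem_nhdsWithin] with ε hε
  exact (hsym ε hε).symm
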